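/- Assume ∫_{{y : p(y_{-k}^k) > 0}} ‖P(X_0 | y_{-k}^k) − P̂(X_0 | y_{-k}^k)‖₁ · p(y_{-k}^k) dy_{-k}^k ≤ ε*, where the densities are instantiated with P = P^k_{x^n}. Let ĥ : ℝ^{2k+1} → A be any measurable rule such that ĥ(y_{-k}^k) is a Bayes response B(P̂(X_0 | y_{-k}^k)) whenever p(y_{-k}^k) > 0. Then |D^k_{x^n} − R(ĥ)| ≤ Λ_max · ε*. -/

import Mathlib

open MeasureTheory Finset

noncomputable section
namespace GenCUDE

/-- The center index of a `(2k+1)`-tuple (0-indexed position `k`). -/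
def center (k : ℕ) : Fin (2*k+1) := ⟨k, by omega⟩

/-- Remove the center coordinate of a `(2k+1)`-tuple, yielding the context (a `2k`-tuple). -/
def dropCenter {α : Type*} (k : ℕ) (y : Fin (2*k+1) → α) : Fin (2*k) → α :=
  fun i => y ((center k).succAbove i)

/-- `p(y_{-k}^k)`: the joint output density of the full `(2k+1)`-tuple. -/
def pFull {M k : ℕ} (f : Fin M → ℝ → ℝ) (P : (Fin (2*k+1) → Fin M) → ℝ)
    (y : Fin (2*k+1) → ℝ) : ℝ :=
  ∑ u : Fin (2*k+1) → Fin M, P u * ∏ j, f (u j) (y j)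

/-- `p(y_{-0})`: the output density of the context. -/
def pCtx {M k : ℕ} (f : Fin M → ℝ → ℝ) (P : (Fin (2*k+1) → Fin M) → ℝ)
    (c : Fin (2*k) → ℝ) : ℝ :=
  ∑ u : Fin (2*k+1) → Fin M, P u * ∏ i, f (dropCenter k u i) (c i)

/-- `p(a, y_{-k}^k)`. -/
def pJoint {M k : ℕ} (f : Fin M → ℝ → ℝ) (P : (Fin (2*k+1) → Fin M) → ℝ)
    (a : Fin M) (y : Fin (2*k+1) → ℝ) : ℝ :=
  ∑ u : Fin (2*k+1) → Fin M,
    (if u (center k) = a then P u * ∏ j, f (u j) (y j) else 0)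

/-- `p(a, y_{-0})`. -/
def pJointCtx {M k : ℕ} (f : Fin M → ℝ → ℝ) (P : (Fin (2*k+1) → Fin M) → ℝ)
    (a : Fin M) (c : Fin (2*k) → ℝ) : ℝ :=
  ∑ u : Fin (2*k+1) → Fin M,
    (if u (center k) = a then P u * ∏ i, f (dropCenter k u i) (c i) else 0)

/-- `P(X_0 = · | y_{-k}^k)`. -/
def postFull {M k : ℕ} (f : Fin M → ℝ → ℝ) (P : (Fin (2*k+1) → Fin M) → ℝ)
    (y : Fin (2*k+1) → ℝ) : Fin M → ℝ :=
  fun a => pJoint f P a y / pFull f P y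

/-- `P(X_0 = · | y_{-0})`. -/
def postCtx {M k : ℕ} (f : Fin M → ℝ → ℝ) (P : (Fin (2*k+1) → Fin M) → ℝ)
    (c : Fin (2*k) → ℝ) : Fin M → ℝ :=
  fun a => pJointCtx f P a c / pCtx f P c

/-- `P(Z_0 = · | y_{-0}) = Σ_a P(X_0=a | y_{-0}) Π(a,·)`. -/
def PZ {M k : ℕ} (f : Fin M → ℝ → ℝ) (P : (Fin (2*k+1) → Fin M) → ℝ)
    (Pi : Matrix (Fin M) (Fin M) ℝ) (c : Fin (2*k) → ℝ) : Fin M → ℝ :=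
  fun z => ∑ a, postCtx f P c a * Pi a z

/-- The approximate posterior `P̂(X_0 = · | y_{-k}^k)` built from the network output `g`. -/
def postHat {M k : ℕ} (f : Fin M → ℝ → ℝ) (P : (Fin (2*k+1) → Fin M) → ℝ)
    (Pi : Matrix (Fin M) (Fin M) ℝ) (g : (Fin (2*k) → ℝ) → Fin M → ℝ)
    (y : Fin (2*k+1) → ℝ) : Fin M → ℝ :=
  fun a => (pCtx f P (dropCenter k y) / pFull f P y)
      * (∑ z, g (dropCenter k y) z * Pi⁻¹ z a) * f a (y (center k))

/-- `b` is a Bayes response with respect to (the not necessarily normalized vector) `v`. -/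
def IsBayes {M : ℕ} (Λ : Matrix (Fin M) (Fin M) ℝ) (v : Fin M → ℝ) (b : Fin M) : Prop :=
  ∀ c : Fin M, ∑ a, Λ a b * v a ≤ ∑ a, Λ a c * v a

/-- Single-letter risk `R(h)` of a sliding-window rule `h` under `P ⊗ C`. -/
def risk {M k : ℕ} (f : Fin M → ℝ → ℝ) (P : (Fin (2*k+1) → Fin M) → ℝ)
    (Λ : Matrix (Fin M) (Fin M) ℝ) (h : (Fin (2*k+1) → ℝ) → Fin M) : ℝ :=
  ∑ u : Fin (2*k+1) → Fin M,
    P u * ∫ y : Fin (2*k+1) → ℝ, Λ (u (center k)) (h y) * ∏ j, f (u j) (y j)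

/-- Extend a `Fin n`-indexed sequence to `ℕ` by zero. -/
def ext {n : ℕ} (y : Fin n → ℝ) : ℕ → ℝ := fun m => if h : m < n then y ⟨m, h⟩ else 0

/-- The window `y_{i-k}^{i+k}` (0-indexed center `i`). -/
def window (k : ℕ) (y : ℕ → ℝ) (i : ℕ) : Fin (2*k+1) → ℝ := fun j => y (i - k + j.val)

/-- The empirical distribution of `(2k+1)`-blocks of `x^n` (0-indexed positions `0,…,n-1`). -/
def empDist (M n k : ℕ) (x : ℕ → Fin M) : (Fin (2*k+1) → Fin M) → ℝ :=
  fun u => (((Finset.Ico k (n - k)).filter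
      fun i => ∀ j : Fin (2*k+1), x (i - k + j.val) = u j).card : ℝ) / ((n - 2*k : ℕ) : ℝ)

/-- The law of `Y^n`: independent coordinates, `Y_i` with density `f_{x_i}`. -/
def lawSeq {M : ℕ} (n : ℕ) (f : Fin M → ℝ → ℝ) (x : ℕ → Fin M) : Measure (Fin n → ℝ) :=
  Measure.pi fun i : Fin n => volume.withDensity fun t => ENNReal.ofReal (f (x i.val) t)

/-- The joint law of the `(2k+1)` noisy outputs under `P ⊗ C`. -/
def lawBlock {M k : ℕ} (f : Fin M → ℝ → ℝ) (P : (Fin (2*k+1) → Fin M) → ℝ) :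
    Measure (Fin (2*k+1) → ℝ) :=
  ∑ u : Fin (2*k+1) → Fin M, ENNReal.ofReal (P u) •
    Measure.pi fun j => volume.withDensity fun t => ENNReal.ofReal (f (u j) t)

/-- The average loss of the sliding-window rule `h` on `(x^n, y^n)`. -/
def avgLoss {M : ℕ} (n k : ℕ) (Λ : Matrix (Fin M) (Fin M) ℝ) (x : ℕ → Fin M)
    (h : (Fin (2*k+1) → ℝ) → Fin M) (y : Fin n → ℝ) : ℝ :=
  (((n - 2*k : ℕ) : ℝ))⁻¹ * ∑ i ∈ Finset.Ico k (n - k), Λ (x i) (h (window k (ext y) i))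


lemma integrable_of_density {φ : ℝ → ℝ} (h : ∫ t, φ t = 1) : Integrable φ := by
  by_contra hc
  rw [integral_undef hc] at h
  exact zero_ne_one h

lemma isProb_density {φ : ℝ → ℝ} (h0 : ∀ t, 0 ≤ φ t) (h : ∫ t, φ t = 1) :
    IsProbabilityMeasure (volume.withDensity fun t => ENNReal.ofReal (φ t)) := by
  constructor
  rw [withDensity_apply _ MeasurableSet.univ, Measure.restrict_univ,
    ← ofReal_integral_eq_lintegral_ofReal (integrable_of_density h) (ae_of_all _ h0), h]
  simp

lemma pi_withDensity_eq {ι : Type*} [Fintype ι] (φ : ι → ℝ → ℝ)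
    (h0 : ∀ i t, 0 ≤ φ i t) (h : ∀ i, ∫ t, φ i t = 1) :
    Measure.pi (fun i => volume.withDensity fun t => ENNReal.ofReal (φ i t))
      = (volume : Measure (ι → ℝ)).withDensity fun y => ENNReal.ofReal (∏ i, φ i (y i)) := by
  have hp := fun i => isProb_density (h0 i) (h i)
  refine Measure.pi_eq fun s hs => ?_
  rw [withDensity_apply _ (MeasurableSet.univ_pi hs), volume_pi, Measure.restrict_pi_pi,
    ← ofReal_integral_eq_lintegral_ofReal
      (Integrable.fintype_prod fun i => (integrable_of_density (h i)).restrict)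
      (ae_of_all _ fun y => Finset.prod_nonneg fun i _ => h0 i _),
    integral_fintype_prod_eq_prod, ENNReal.ofReal_prod_of_nonneg
      (fun i _ => integral_nonneg (h0 i))]
  refine Finset.prod_congr rfl fun i _ => ?_
  rw [withDensity_apply _ (hs i), ofReal_integral_eq_lintegral_ofReal
    (integrable_of_density (h i)).restrict (ae_of_all _ (h0 i))]

lemma measurable_window {n k i : ℕ} :
    Measurable fun y : Fin n → ℝ => window k (ext y) i := by
  refine measurable_pi_lambda _ fun j => ?_
  unfold window ext
  by_cases h : i - k + j.val < n
  · simp only [h, dite_true]; exact measurable_pi_apply _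
  · simp only [h, dite_false]; exact measurable_const

lemma map_window {M n k i : ℕ} (hi : k ≤ i) (hi' : i < n - k) (f : Fin M → ℝ → ℝ)
    (h0 : ∀ a t, 0 ≤ f a t) (h : ∀ a, ∫ t, f a t = 1) (x : ℕ → Fin M) :
    (lawSeq n f x).map (fun y => window k (ext y) i)
      = (volume : Measure (Fin (2*k+1) → ℝ)).withDensity fun y =>
        ENNReal.ofReal (∏ j : Fin (2*k+1), f (x (i - k + j.val)) (y j)) := by
  have hp := fun a => isProb_density (h0 a) (h a)
  have hlt : ∀ j : Fin (2*k+1), i - k + j.val < n := fun j => by have := j.2; omega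
  let e : Fin (2*k+1) → Fin n := fun j => ⟨i - k + j.val, hlt j⟩
  have he : Function.Injective e := by
    intro a b hab
    simp only [e, Fin.mk.injEq] at hab
    exact Fin.ext (by omega)
  have hw : (fun y : Fin n → ℝ => window k (ext y) i) = fun y j => y (e j) := by
    funext y j
    simp [window, ext, hlt, e]
  have hind := (ProbabilityTheory.iIndepFun_pi (X := fun (_ : Fin n) (t : ℝ) => t)
    (μ := fun i : Fin n => volume.withDensity fun t => ENNReal.ofReal (f (x i.val) t))
    (fun _ => aemeasurable_id)).precomp he
  rw [hw]
  unfold lawSeq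
  rw [ProbabilityTheory.iIndepFun_iff_map_fun_eq_pi_map
    (fun j => (measurable_pi_apply _).aemeasurable)] at hind
  rw [hind, ← pi_withDensity_eq (fun j : Fin (2*k+1) => f (x (i - k + j.val)))
    (fun j => h0 _) (fun j => h _)]
  congr 1
  funext j
  exact (measurePreserving_eval _ (e j)).map_eq

lemma integral_window {M n k i : ℕ} (hi : k ≤ i) (hi' : i < n - k) (f : Fin M → ℝ → ℝ)
    (hm : ∀ a, Measurable (f a))
    (h0 : ∀ a t, 0 ≤ f a t) (h : ∀ a, ∫ t, f a t = 1) (x : ℕ → Fin M)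
    (F : (Fin (2*k+1) → ℝ) → ℝ) (hF : Measurable F) :
    ∫ y, F (window k (ext y) i) ∂(lawSeq n f x)
      = ∫ y, F y * ∏ j : Fin (2*k+1), f (x (i - k + j.val)) (y j) := by
  rw [← integral_map (f := F) measurable_window.aemeasurable hF.aestronglyMeasurable,
    map_window hi hi' f h0 h x, integral_withDensity_eq_integral_toReal_smul]
  · refine integral_congr_ae (ae_of_all _ fun y => ?_)
    simp only [smul_eq_mul]
    rw [ENNReal.toReal_ofReal (Finset.prod_nonneg fun j _ => h0 _ _), mul_comm]
  · exact (Finset.measurable_prod _ fun j _ =>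
      (hm _).comp (measurable_pi_apply j)).ennreal_ofReal
  · exact ae_of_all _ fun y => ENNReal.ofReal_lt_top

lemma sum_empDist {M n k : ℕ} (x : ℕ → Fin M) (F : (Fin (2*k+1) → Fin M) → ℝ) :
    ∑ u, empDist M n k x u * F u = (((n - 2*k : ℕ) : ℝ))⁻¹ *
      ∑ i ∈ Finset.Ico k (n - k), F (fun j => x (i - k + j.val)) := by
  have : ∀ i ∈ Finset.Ico k (n - k), F (fun j => x (i - k + j.val))
      = ∑ u, if (∀ j : Fin (2*k+1), x (i - k + j.val) = u j) then F u else 0 := by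
    intro i _
    simp_rw [← funext_iff (f := fun j : Fin (2*k+1) => x (i - k + j.val))]
    simp
  rw [Finset.sum_congr rfl this, Finset.sum_comm, Finset.mul_sum]
  refine Finset.sum_congr rfl fun u _ => ?_
  rw [← Finset.sum_filter, Finset.sum_const, nsmul_eq_mul, empDist]
  ring

lemma expected_avgLoss {M n k : ℕ} (f : Fin M → ℝ → ℝ)
    (hm : ∀ a, Measurable (f a))
    (h0 : ∀ a t, 0 ≤ f a t) (h : ∀ a, ∫ t, f a t = 1) (x : ℕ → Fin M)
    (Λ : Matrix (Fin M) (Fin M) ℝ) (Λmax : ℝ) (hΛ : ∀ a b, Λ a b ∈ Set.Icc 0 Λmax)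
    (r : (Fin (2*k+1) → ℝ) → Fin M) (hr : Measurable r) :
    ∫ y, avgLoss n k Λ x r y ∂(lawSeq n f x) = risk f (empDist M n k x) Λ r := by
  have hp := fun a => isProb_density (h0 a) (h a)
  have : IsProbabilityMeasure (lawSeq n f x) := by unfold lawSeq; infer_instance
  unfold avgLoss risk
  rw [sum_empDist x (fun u => ∫ y : Fin (2*k+1) → ℝ, Λ (u (center k)) (r y)
    * ∏ j, f (u j) (y j)), integral_const_mul, integral_finsetSum]
  · congr 1
    refine Finset.sum_congr rfl fun i hi => ?_
    rw [Finset.mem_Ico] at hi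
    have hc : i - k + (center k).val = i := by simp [center]; omega
    rw [integral_window hi.1 hi.2 f hm h0 h x (fun w => Λ (x i) (r w))
      ((measurable_of_finite (Λ (x i))).comp hr)]
    simp only [hc]
  · intro i _
    refine Integrable.of_bound
      (((measurable_of_finite (Λ (x i))).comp (hr.comp measurable_window)).aestronglyMeasurable)
      Λmax (ae_of_all _ fun y => ?_)
    rw [Real.norm_of_nonneg (hΛ _ _).1]
    exact (hΛ _ _).2

lemma integrable_block {M k : ℕ} (f : Fin M → ℝ → ℝ) (h : ∀ a, ∫ t, f a t = 1)
    (u : Fin (2*k+1) → Fin M) :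
    Integrable fun y : Fin (2*k+1) → ℝ => ∏ j, f (u j) (y j) :=
  Integrable.fintype_prod fun j => integrable_of_density (h (u j))

lemma integrable_pJoint {M k : ℕ} (f : Fin M → ℝ → ℝ) (h : ∀ a, ∫ t, f a t = 1)
    (P : (Fin (2*k+1) → Fin M) → ℝ) (a : Fin M) :
    Integrable (pJoint f P a) := by
  unfold pJoint
  refine integrable_finsetSum _ fun u _ => ?_
  by_cases hu : u (center k) = a
  · simpa only [hu, if_true] using (integrable_block f h u).const_mul (P u)
  · simp [hu]

lemma pCtx_mul {M k : ℕ} (f : Fin M → ℝ → ℝ)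
    (P : (Fin (2*k+1) → Fin M) → ℝ) (a : Fin M) (y : Fin (2*k+1) → ℝ) :
    pCtx f P (dropCenter k y) * f a (y (center k))
      = ∑ u, P u * ∏ j, f (Function.update u (center k) a j) (y j) := by
  unfold pCtx
  rw [Finset.sum_mul]
  refine Finset.sum_congr rfl fun u _ => ?_
  rw [Fin.prod_univ_succAbove _ (center k)]
  simp only [Function.update_self, ne_eq, Fin.succAbove_ne, not_false_eq_true,
    Function.update_of_ne, dropCenter]
  ring

lemma integrable_hat {M k : ℕ} (f : Fin M → ℝ → ℝ) (h : ∀ a, ∫ t, f a t = 1)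
    (P : (Fin (2*k+1) → Fin M) → ℝ) (Pi : Matrix (Fin M) (Fin M) ℝ)
    (g : (Fin (2*k) → ℝ) → Fin M → ℝ) (hg_meas : Measurable g)
    (hg_simplex : ∀ c, (∀ z, 0 ≤ g c z) ∧ ∑ z, g c z = 1) (a : Fin M) :
    Integrable fun y : Fin (2*k+1) → ℝ => (∑ z, g (dropCenter k y) z * Pi⁻¹ z a) *
      (pCtx f P (dropCenter k y) * f a (y (center k))) := by
  refine Integrable.bdd_mul (c := ∑ z, |Pi⁻¹ z a|) ?_ ?_ (ae_of_all _ fun y => ?_)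
  · simp_rw [pCtx_mul]
    exact integrable_finsetSum _ fun u _ => (integrable_block f h _).const_mul (P u)
  · refine Measurable.aestronglyMeasurable (Finset.measurable_sum _ fun z _ => ?_)
    have hd : Measurable fun y : Fin (2*k+1) → ℝ => dropCenter k y :=
      measurable_pi_lambda _ fun i => measurable_pi_apply _
    exact ((measurable_pi_apply z).comp (hg_meas.comp hd)).mul_const _
  · refine (norm_sum_le _ _).trans (Finset.sum_le_sum fun z _ => ?_)
    obtain ⟨h1, h2⟩ := hg_simplex (dropCenter k y)
    rw [Real.norm_eq_abs, abs_mul, abs_of_nonneg (h1 z)]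
    have : g (dropCenter k y) z ≤ 1 := h2 ▸ Finset.single_le_sum (fun i _ => h1 i) (mem_univ z)
    exact mul_le_of_le_one_left (abs_nonneg _) this

lemma risk_eq {M k : ℕ} (f : Fin M → ℝ → ℝ) (h : ∀ a, ∫ t, f a t = 1)
    (P : (Fin (2*k+1) → Fin M) → ℝ)
    (Λ : Matrix (Fin M) (Fin M) ℝ) (Λmax : ℝ) (hΛ : ∀ a b, Λ a b ∈ Set.Icc 0 Λmax)
    (r : (Fin (2*k+1) → ℝ) → Fin M) (hr : Measurable r) :
    Integrable (fun y => ∑ a, Λ a (r y) * pJoint f P a y) ∧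
    risk f P Λ r = ∫ y, ∑ a, Λ a (r y) * pJoint f P a y := by
  have hb : ∀ a (F : (Fin (2*k+1) → ℝ) → ℝ), Integrable F →
      Integrable fun y => Λ a (r y) * F y := by
    intro a F hF
    refine hF.bdd_mul (c := Λmax)
      ((measurable_of_finite (Λ a)).comp hr).aestronglyMeasurable (ae_of_all _ fun y => ?_)
    rw [Real.norm_of_nonneg (hΛ _ _).1]
    exact (hΛ _ _).2
  refine ⟨integrable_finsetSum _ fun a _ => hb a _ (integrable_pJoint f h P a), ?_⟩
  unfold risk
  simp_rw [← integral_const_mul]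
  rw [← integral_finsetSum]
  · refine integral_congr_ae (ae_of_all _ fun y => ?_)
    simp only [pJoint, Finset.mul_sum]
    rw [Finset.sum_comm]
    refine Finset.sum_congr rfl fun u _ => ?_
    simp only [mul_ite, mul_zero, Finset.sum_ite_eq, mem_univ, if_true]
    ring
  · intro u _
    exact (hb _ _ (integrable_block f h u)).const_mul _

lemma empDist_nonneg {M n k : ℕ} (x : ℕ → Fin M) (u : Fin (2*k+1) → Fin M) :
    0 ≤ empDist M n k x u := by unfold empDist; positivity

/-- Lemma 4 of the paper: with `P = P^k_{x^n}`, if the weighted `L¹`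
posterior-approximation error is at most `ε*` and `ĥ` is a measurable Bayes-response rule
for the approximate posterior `P̂`, then `|D^k_{x^n} − R(ĥ)| ≤ Λ_max · ε*`. -/
theorem statement9
    (M n k : ℕ) (hM : 2 ≤ M) (hk : 1 ≤ k) (hn : 2*k < n)
    (f : Fin M → ℝ → ℝ) (hf_meas : ∀ a, Measurable (f a))
    (hf_nonneg : ∀ a t, 0 ≤ f a t) (hf_int : ∀ a, ∫ t, f a t = 1)
    (Q : ℝ → Fin M) (hQ : Measurable Q)
    (Pi : Matrix (Fin M) (Fin M) ℝ)
    (hPi : ∀ a z, Pi a z = ∫ t in {s : ℝ | Q s = z}, f a t)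
    (hPi_inv : IsUnit Pi.det)
    (Λ : Matrix (Fin M) (Fin M) ℝ) (Λmax : ℝ) (hΛmax : 0 < Λmax)
    (hΛ : ∀ a b, Λ a b ∈ Set.Icc 0 Λmax)
    (x : ℕ → Fin M)
    (g : (Fin (2*k) → ℝ) → Fin M → ℝ) (hg_meas : Measurable g)
    (hg_simplex : ∀ c, (∀ z, 0 ≤ g c z) ∧ ∑ z, g c z = 1)
    (εstar : ℝ)
    (happrox : ∫ y in {y : Fin (2*k+1) → ℝ | 0 < pFull f (empDist M n k x) y},
        (∑ a, |postFull f (empDist M n k x) y a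
              - postHat f (empDist M n k x) Pi g y a|) * pFull f (empDist M n k x) y
      ≤ εstar)
    (hhat : (Fin (2*k+1) → ℝ) → Fin M) (hhat_meas : Measurable hhat)
    (hhat_bayes : ∀ y : Fin (2*k+1) → ℝ, 0 < pFull f (empDist M n k x) y →
      IsBayes Λ (postHat f (empDist M n k x) Pi g y) (hhat y)) :
    |(⨅ gk : {g' : (Fin (2*k+1) → ℝ) → Fin M // Measurable g'},
        ∫ y : Fin n → ℝ, avgLoss n k Λ x gk.1 y ∂(lawSeq n f x))
      - risk f (empDist M n k x) Λ hhat| ≤ Λmax * εstar := by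
  have hP : ∀ u, 0 ≤ empDist M n k x u := empDist_nonneg x
  set P := empDist M n k x with hPdef
  simp_rw [expected_avgLoss f hf_meas hf_nonneg hf_int x Λ Λmax hΛ _ (Subtype.prop _)]
  rw [← hPdef]
  have hterm : ∀ u (y : Fin (2*k+1) → ℝ), 0 ≤ P u * ∏ j, f (u j) (y j) := fun u y =>
    mul_nonneg (hP u) (Finset.prod_nonneg fun j _ => hf_nonneg _ _)
  have hJ0 : ∀ a y, 0 ≤ pJoint f P a y := fun a y => by
    unfold pJoint
    refine Finset.sum_nonneg fun u _ => ?_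
    split_ifs
    · exact hterm u y
    · exact le_rfl
  have hJF : ∀ a y, pJoint f P a y ≤ pFull f P y := fun a y => by
    unfold pJoint pFull
    refine Finset.sum_le_sum fun u _ => ?_
    split_ifs
    · exact le_rfl
    · exact hterm u y
  have hpm : Measurable (pFull f P) := by
    unfold pFull
    exact Finset.measurable_sum _ fun u _ => (Finset.measurable_prod _ fun j _ =>
      (hf_meas _).comp (measurable_pi_apply j)).const_mul _
  -- the error integrand, without divisions
  set S : Set (Fin (2*k+1) → ℝ) := {y | 0 < pFull f P y} with hS
  have hSm : MeasurableSet S := measurableSet_lt measurable_const hpm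
  let H : Fin M → (Fin (2*k+1) → ℝ) → ℝ := fun a y =>
    (∑ z, g (dropCenter k y) z * Pi⁻¹ z a) *
      (pCtx f P (dropCenter k y) * f a (y (center k)))
  let E : (Fin (2*k+1) → ℝ) → ℝ := fun y => ∑ a, |pJoint f P a y - H a y|
  have hEint : Integrable E := integrable_finsetSum _ fun a _ =>
    ((integrable_pJoint f hf_int P a).sub
      (integrable_hat f hf_int P Pi g hg_meas hg_simplex a)).abs
  have hHat : ∀ y ∈ S, ∀ a, postHat f P Pi g y a * pFull f P y = H a y := by
    intro y hy a
    have : pFull f P y ≠ 0 := ne_of_gt hy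
    simp only [postHat, H]
    field_simp
  have hPost : ∀ y ∈ S, ∀ a, postFull f P y a * pFull f P y = pJoint f P a y := by
    intro y hy a
    have : pFull f P y ≠ 0 := ne_of_gt hy
    simp only [postFull]
    field_simp
  have hE : ∫ y in S, E y ≤ εstar := by
    refine le_of_eq_of_le (setIntegral_congr_fun hSm fun y hy => ?_) happrox
    simp only [E]
    rw [Finset.sum_mul]
    refine Finset.sum_congr rfl fun a _ => ?_
    rw [← hHat y hy a, ← hPost y hy a, ← sub_mul, abs_mul, abs_of_pos (show 0 < pFull f P y from hy)]
  have key : ∀ r : (Fin (2*k+1) → ℝ) → Fin M, Measurable r →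
      risk f P Λ hhat ≤ risk f P Λ r + Λmax * εstar := by
    intro r hr
    obtain ⟨i1, e1⟩ := risk_eq f hf_int P Λ Λmax hΛ hhat hhat_meas
    obtain ⟨i2, e2⟩ := risk_eq f hf_int P Λ Λmax hΛ r hr
    have : risk f P Λ hhat - risk f P Λ r ≤ Λmax * ∫ y in S, E y := by
      rw [e1, e2, ← integral_sub i1 i2, ← integral_indicator hSm, ← integral_const_mul]
      refine integral_mono (i1.sub i2) ((hEint.indicator hSm).const_mul _) fun y => ?_
      simp only
      by_cases hy : y ∈ S
      · rw [Set.indicator_of_mem hy]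
        have hb := mul_le_mul_of_nonneg_right (hhat_bayes y hy (r y)) (le_of_lt hy)
        rw [Finset.sum_mul, Finset.sum_mul] at hb
        simp only [mul_assoc, hHat y hy] at hb
        have h3 : ∑ a, (Λ a (hhat y) - Λ a (r y)) * (pJoint f P a y - H a y) ≤ Λmax * E y := by
          simp only [E, Finset.mul_sum]
          refine Finset.sum_le_sum fun a _ => ?_
          refine (le_abs_self _).trans ?_
          rw [abs_mul]
          refine mul_le_mul_of_nonneg_right ?_ (abs_nonneg _)
          have h4 := hΛ a (hhat y)
          have h5 := hΛ a (r y)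
          rw [abs_le]
          constructor <;> linarith [h4.1, h4.2, h5.1, h5.2]
        simp only [sub_mul, mul_sub, Finset.sum_sub_distrib] at h3
        linarith
      · rw [Set.indicator_of_notMem hy]
        have hz : ∀ a, pJoint f P a y = 0 := fun a =>
          le_antisymm ((hJF a y).trans (not_lt.mp hy)) (hJ0 a y)
        simp [hz]
    have := mul_le_mul_of_nonneg_left hE hΛmax.le
    linarith
  have hbdd : BddBelow (Set.range fun gk : {g' : (Fin (2*k+1) → ℝ) → Fin M // Measurable g'} =>
      risk f P Λ gk.1) := by
    refine ⟨risk f P Λ hhat - Λmax * εstar, ?_⟩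
    rintro _ ⟨gk, rfl⟩
    have := key gk.1 gk.2
    simp only
    linarith
  have : Nonempty {g' : (Fin (2*k+1) → ℝ) → Fin M // Measurable g'} := ⟨⟨hhat, hhat_meas⟩⟩
  have up := ciInf_le hbdd ⟨hhat, hhat_meas⟩
  have lo : risk f P Λ hhat - Λmax * εstar ≤
      ⨅ gk : {g' : (Fin (2*k+1) → ℝ) → Fin M // Measurable g'}, risk f P Λ gk.1 :=
    le_ciInf fun gk => by have := key gk.1 gk.2; linarith
  simp only at up
  have hε : 0 ≤ Λmax * εstar := mul_nonneg hΛmax.le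
    ((integral_nonneg fun y => Finset.sum_nonneg fun a _ => abs_nonneg _).trans hE)
  rw [abs_le]
  constructor <;> linarith

end GenCUDE
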